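/- arXiv:2306.15283 — 6 statements merged into one kernel-verified Lean document; each statement's English description precedes it below -/
import Mathlib

section
/- Let q̃, π̃: ℝ^d → (0,∞) be measurable with Z_q = ∫ q̃ dz < ∞, Z_π = ∫ π̃ dz < ∞, and suppose q̃·|log(q̃/π̃)| is Lebesgue integrable. Let η: ℝ^d → ℝ be bounded and measurable. For ε ∈ ℝ define J_KL(ε) = (∫ q̃(z) e^{εη(z)} log(q̃(z)e^{εη(z)}/π̃(z)) dz)/(∫ q̃(z) e^{εη(z)} dz) + log Z_π − log ∫ q̃(z) e^{εη(z)} dz (which equals the KL divergence D_KL(q_ε || π) of the normalized perturbed density q_ε ∝ q̃ e^{εη} from π = π̃/Z_π). Then J_KL is differentiable at ε = 0 and J_KL′(0) = Cov_q[η(z), log(q̃(z)/π̃(z))], where q = q̃/Z_q. -/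
open MeasureTheory Real

lemma MeasureTheory.Integrable.mul_exp_mul_of_bounded {α : Type*} [MeasurableSpace α]
    {μ : Measure α} {f η : α → ℝ} {C : ℝ} (hf : Integrable f μ)
    (hη : Measurable η) (hC : ∀ z, |η z| ≤ C) (x : ℝ) :
    Integrable (fun z => f z * Real.exp (x * η z)) μ := by
  refine hf.mul_bdd (c := Real.exp (|x| * C)) (by fun_prop) (.of_forall fun z => ?_)
  rw [Real.norm_eq_abs, Real.abs_exp, Real.exp_le_exp]
  calc x * η z ≤ |x * η z| := le_abs_self _
    _ = |x| * |η z| := abs_mul _ _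
    _ ≤ |x| * C := by gcongr; exact hC z

lemma hasDerivAt_integral_mul_exp_mul {α : Type*} [MeasurableSpace α]
    {μ : Measure α} {f η : α → ℝ} {C : ℝ} (hf : Integrable f μ)
    (hη : Measurable η) (hC : ∀ z, |η z| ≤ C) (x₀ : ℝ) :
    HasDerivAt (fun x => ∫ z, f z * Real.exp (x * η z) ∂μ)
      (∫ z, f z * (η z * Real.exp (x₀ * η z)) ∂μ) x₀ := by
  refine (hasDerivAt_integral_of_dominated_loc_of_deriv_le
    (F := fun x z => f z * Real.exp (x * η z))
    (F' := fun x z => f z * (η z * Real.exp (x * η z)))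
    (bound := fun z => |f z| * (C * Real.exp ((|x₀| + 1) * C)))
    (Metric.ball_mem_nhds x₀ one_pos)
    (.of_forall fun x => (hf.mul_exp_mul_of_bounded hη hC x).aestronglyMeasurable)
    (hf.mul_exp_mul_of_bounded hη hC x₀)
    (hf.aestronglyMeasurable.mul (by fun_prop))
    (.of_forall fun z x hx => ?_) (hf.abs.mul_const _) (.of_forall fun z x _ => ?_)).2
  · have hx : |x| ≤ |x₀| + 1 := by
      rw [Metric.mem_ball, Real.dist_eq] at hx
      linarith [abs_sub_abs_le_abs_sub x x₀]
    have hC₀ : 0 ≤ C := (abs_nonneg _).trans (hC z)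
    have hexp : x * η z ≤ (|x₀| + 1) * C :=
      calc x * η z ≤ |x * η z| := le_abs_self _
        _ = |x| * |η z| := abs_mul _ _
        _ ≤ (|x₀| + 1) * C := by gcongr; exact hC z
    rw [Real.norm_eq_abs, abs_mul, abs_mul, Real.abs_exp]
    gcongr
    exact hC z
  · have h := ((hasDerivAt_mul_const (x := x) (η z)).exp).const_mul (f z)
    rwa [mul_comm (Real.exp _)] at h

/-- Lemma 3.1, inverse-KL directional derivative.
Let `q̃, π̃ : ℝ^d → (0,∞)` be measurable with finite integrals, with
`q̃·|log(q̃/π̃)|` integrable, and let `η` be bounded measurable.  For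
`ε ∈ ℝ` let `J ε` be the KL divergence of the normalized perturbed density
`q_ε ∝ q̃ e^{εη}` from `π = π̃/Z_π`, written out with unnormalized densities.
Then `J` is differentiable at `0` with derivative
`Cov_q[η, log(q̃/π̃)]` where `q = q̃/Z_q`. -/
theorem inverse_KL_directional_derivative
    (d : ℕ) (qt πt η : (Fin d → ℝ) → ℝ)
    (hq_pos : ∀ z, 0 < qt z) (hπ_pos : ∀ z, 0 < πt z)
    (hq_meas : Measurable qt) (hπ_meas : Measurable πt)
    (hq_int : Integrable qt) (hπ_int : Integrable πt)
    (hlog_int : Integrable (fun z => qt z * |Real.log (qt z / πt z)|))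
    (hη_meas : Measurable η) (hη_bdd : ∃ C : ℝ, ∀ z, |η z| ≤ C)
    (J : ℝ → ℝ)
    (hJ : ∀ ε : ℝ, J ε =
      (∫ z, qt z * Real.exp (ε * η z) *
          Real.log (qt z * Real.exp (ε * η z) / πt z)) /
        (∫ z, qt z * Real.exp (ε * η z))
      + Real.log (∫ z, πt z) - Real.log (∫ z, qt z * Real.exp (ε * η z))) :
    HasDerivAt J
      ((∫ z, qt z * (η z * Real.log (qt z / πt z))) / (∫ z, qt z)
        - ((∫ z, qt z * η z) / (∫ z, qt z)) *
          ((∫ z, qt z * Real.log (qt z / πt z)) / (∫ z, qt z))) 0 := by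
  obtain ⟨C, hC⟩ := hη_bdd
  have hL_int : Integrable (fun z => qt z * Real.log (qt z / πt z)) := by
    refine hlog_int.mono (by fun_prop) (.of_forall fun z => ?_)
    simp
  have hqη_int : Integrable (fun z => qt z * η z) :=
    hq_int.mul_bdd (c := C) (by fun_prop) (.of_forall hC)
  have hsplit : ∀ ε : ℝ, (∫ z, qt z * Real.exp (ε * η z) *
        Real.log (qt z * Real.exp (ε * η z) / πt z)) =
      (∫ z, qt z * Real.log (qt z / πt z) * Real.exp (ε * η z)) +
        ε * ∫ z, qt z * η z * Real.exp (ε * η z) := by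
    intro ε
    rw [← integral_const_mul, ← integral_add (hL_int.mul_exp_mul_of_bounded hη_meas hC ε)
      ((hqη_int.mul_exp_mul_of_bounded hη_meas hC ε).const_mul ε)]
    refine integral_congr_ae (.of_forall fun z => ?_)
    have hlog : Real.log (qt z * Real.exp (ε * η z) / πt z) =
        Real.log (qt z / πt z) + ε * η z := by
      rw [mul_div_right_comm, Real.log_mul (div_pos (hq_pos z) (hπ_pos z)).ne'
        (Real.exp_ne_zero _), Real.log_exp]
    simp only [hlog]
    ring
  have hZ_pos : 0 < ∫ z, qt z := by
    refine (integral_pos_iff_support_of_nonneg (fun z => (hq_pos z).le) hq_int).2 ?_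
    have hsupp : Function.support qt = Set.univ :=
      Set.eq_univ_of_forall fun z => (hq_pos z).ne'
    rw [hsupp]
    exact Measure.measure_univ_pos.2 (NeZero.ne _)
  have hZ := hasDerivAt_integral_mul_exp_mul hq_int hη_meas hC 0
  have hL := hasDerivAt_integral_mul_exp_mul hL_int hη_meas hC 0
  have hqη := hasDerivAt_integral_mul_exp_mul hqη_int hη_meas hC 0
  have hZ₀ : (∫ z, qt z * Real.exp (0 * η z)) ≠ 0 := by simpa using hZ_pos.ne'
  have hderiv := (((hL.add ((hasDerivAt_id (0 : ℝ)).mul hqη)).div hZ hZ₀).add_const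
    (Real.log (∫ z, πt z))).sub (hZ.log hZ₀)
  refine (hderiv.congr_of_eventuallyEq (.of_forall fun ε => ?_)).congr_deriv ?_
  · simp [hJ, hsplit]
  · have hcomm : (∫ z, qt z * Real.log (qt z / πt z) * η z) =
        ∫ z, qt z * (η z * Real.log (qt z / πt z)) :=
      integral_congr_ae (.of_forall fun z => by ring)
    simp only [Pi.add_apply, Pi.mul_apply, id, zero_mul, Real.exp_zero, mul_one, one_mul,
      add_zero, hcomm]
    field_simp
    ring
end

section
/- Let q̃_0, π̃: ℝ^d → (0,∞) be measurable, let B > 0, and let β: [0,∞) → (0,1] be differentiable with β(0) = 1. For t ≥ 0 define the geometric path φ_t(z) = β(t)·log q̃_0(z) + (1 − β(t))·log π̃(z) and q̃_t(z) = e^{φ_t(z)}, and assume for every t that Z_{q_t} = ∫ q̃_t dz < ∞ and that v(t) := Var_{q_t}[log(π̃(z)/q̃_t(z))] ∈ (0,∞), where q_t = q̃_t/Z_{q_t}; set c_t = B/v(t). If β satisfies the differential equation β′(t) = −(c_t/√B)·β(t) for all t ≥ 0, then for every z ∈ ℝ^d and t ≥ 0, (d/dt) φ_t(z) = (c_t/√B)·log(π̃(z)/q̃_t(z));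 i.e. the geometric mean path solves the steepest-descent ODE ∂_t φ_t = η*_{q_t,π} with η*_{q_t,π}(z) = (c_t/√B)·log(π̃(z)/q̃_t(z)). -/
open MeasureTheory Real

/-- Proposition 3.2, geometric path solves the steepest-descent ODE.
With the geometric path `φ_t(z) = β(t)·log q̃_0(z) + (1-β(t))·log π̃(z)`,
`q̃_t = e^{φ_t}`, `v(t) = Var_{q_t}[log(π̃/q̃_t)] ∈ (0,∞)`, `c_t = B/v(t)`,
if `β′(t) = -(c_t/√B)·β(t)` on `[0,∞)` then for every `z` and `t ≥ 0`,
`(d/dt) φ_t(z) = (c_t/√B)·log(π̃(z)/q̃_t(z))`. -/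
theorem geometric_path_solves_steepest_descent_ODE
    (d : ℕ) (q0t πt : (Fin d → ℝ) → ℝ) (B : ℝ) (β : ℝ → ℝ)
    (hq0_pos : ∀ z, 0 < q0t z) (hπ_pos : ∀ z, 0 < πt z)
    (hq0_meas : Measurable q0t) (hπ_meas : Measurable πt)
    (hB : 0 < B)
    (hβ_range : ∀ t ≥ (0:ℝ), β t ∈ Set.Ioc (0:ℝ) 1) (hβ0 : β 0 = 1)
    (φ : ℝ → (Fin d → ℝ) → ℝ)
    (hφ : ∀ t z, φ t z = β t * Real.log (q0t z) + (1 - β t) * Real.log (πt z))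
    (qt : ℝ → (Fin d → ℝ) → ℝ)
    (hqt : ∀ t z, qt t z = Real.exp (φ t z))
    (hqt_int : ∀ t ≥ (0:ℝ), Integrable (qt t))
    (v : ℝ → ℝ)
    (hv : ∀ t, v t =
      (∫ z, qt t z * (Real.log (πt z / qt t z)) ^ 2) / (∫ z, qt t z)
        - ((∫ z, qt t z * Real.log (πt z / qt t z)) / (∫ z, qt t z)) ^ 2)
    (hv_pos : ∀ t ≥ (0:ℝ), 0 < v t)
    (c : ℝ → ℝ) (hc : ∀ t, c t = B / v t)
    (hβ' : ∀ t ≥ (0:ℝ),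
      HasDerivWithinAt β (-(c t / Real.sqrt B) * β t) (Set.Ici 0) t) :
    ∀ t ≥ (0:ℝ), ∀ z,
      HasDerivWithinAt (fun s => φ s z)
        ((c t / Real.sqrt B) * Real.log (πt z / qt t z)) (Set.Ici 0) t := by
  intro t ht z
  have hlog : Real.log (πt z / qt t z)
      = β t * (Real.log (πt z) - Real.log (q0t z)) := by
    rw [hqt, Real.log_div (hπ_pos z).ne' (Real.exp_pos _).ne', Real.log_exp, hφ]
    ring
  have hderiv := ((hβ' t ht).mul_const (Real.log (q0t z))).add
    (((hβ' t ht).const_sub 1).mul_const (Real.log (πt z)))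
  refine (hderiv.congr_deriv ?_).congr (fun s _ => hφ s z) (hφ t z)
  rw [hlog]
  ring
end

section
/- Let f: (0,∞) → ℝ be convex and continuously differentiable, and let q̃, π̃: ℝ^d → (0,∞) be measurable with Z_q = ∫ q̃ dz < ∞ and Z_π = ∫ π̃ dz < ∞. Let η: ℝ^d → ℝ be bounded and measurable. For ε ∈ ℝ let q̃_ε = q̃ e^{εη}, q_ε = q̃_ε/∫q̃_ε, u_ε(z) = (π̃(z)/q̃_ε(z))/E_{q_ε}[π̃/q̃_ε], and J_f(ε) = E_{q_ε}[f(u_ε(z))]. Write u(z) = u_0(z) = (π̃(z)/q̃(z))·(Z_q/Z_π) and g(u) = u f′(u) − f(u). Assume that for some c > 0 the function z ↦ q̃(z)·sup_{λ ∈ [e^{−c}, e^{c}]} ( |f(λ u(z))| + λ u(z) |f′(λ u(z))| ) is integrable. Then J_f is differentiable at ε = 0 and J_f′(0) = Cov_q[η(z), −g(u(z))], where q = q̃/Z_q. -/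
open MeasureTheory Real

lemma ContinuousOn.measurable_comp_of_mem {α : Type*} [MeasurableSpace α] {h : ℝ → ℝ} {s : Set ℝ}
    (hh : ContinuousOn h s) {v : α → ℝ} (hv : Measurable v) (hvs : ∀ z, v z ∈ s) :
    Measurable fun z => h (v z) :=
  hh.domRestrict.measurable.comp (hv.subtype_mk (h := hvs))

lemma exp_mul_le_of_abs_le {C a ε R : ℝ} (ha : |a| ≤ C) (hε : |ε| ≤ R) :
    exp (ε * a) ≤ exp (R * C) := by
  refine exp_le_exp.2 ((le_abs_self _).trans ?_)
  rw [abs_mul]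
  exact mul_le_mul hε ha (abs_nonneg _) ((abs_nonneg _).trans hε)

section ExponentialTilt

variable {α : Type*} [MeasurableSpace α] {μ : Measure α} {q η : α → ℝ} {C : ℝ}

lemma integrable_mul_exp (hq_int : Integrable q μ) (hη : Measurable η) (hC : ∀ z, |η z| ≤ C)
    (ε : ℝ) : Integrable (fun z => q z * exp (ε * η z)) μ := by
  refine hq_int.mul_bdd (c := exp (|ε| * C)) (by fun_prop) (.of_forall fun z => ?_)
  rw [norm_of_nonneg (exp_pos _).le]
  exact exp_mul_le_of_abs_le (hC z) le_rfl

lemma hasDerivAt_integral_mul_exp (hq_int : Integrable q μ) (hq : ∀ z, 0 < q z)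
    (hη : Measurable η) (hC : ∀ z, |η z| ≤ C) (ε : ℝ) :
    HasDerivAt (fun ε => ∫ z, q z * exp (ε * η z) ∂μ)
      (∫ z, q z * (exp (ε * η z) * η z) ∂μ) ε := by
  have hqm := hq_int.aestronglyMeasurable
  refine (hasDerivAt_integral_of_dominated_loc_of_deriv_le (μ := μ)
    (F := fun ε z => q z * exp (ε * η z)) (F' := fun ε z => q z * (exp (ε * η z) * η z))
    (bound := fun z => q z * (exp ((|ε| + 1) * C) * C)) (Metric.ball_mem_nhds ε one_pos)
    (.of_forall fun x => (integrable_mul_exp hq_int hη hC x).aestronglyMeasurable)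
    (integrable_mul_exp hq_int hη hC ε) (hqm.mul (by fun_prop))
    (.of_forall fun z x hx => ?_) (hq_int.mul_const _) (.of_forall fun z x _ => ?_)).2
  · rw [norm_mul, norm_mul, norm_of_nonneg (exp_pos _).le, norm_of_nonneg (hq z).le]
    have hx' : |x| ≤ |ε| + 1 := by
      have h1 : |x - ε| < 1 := hx
      have h2 := abs_sub_abs_le_abs_sub x ε
      linarith
    exact mul_le_mul_of_nonneg_left (mul_le_mul (exp_mul_le_of_abs_le (hC z) hx') (hC z)
      (abs_nonneg _) (exp_pos _).le) (hq z).le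
  · simpa using ((((hasDerivAt_id x).mul_const (η z)).exp).const_mul (q z))

lemma integral_mul_exp_pos [NeZero μ] (hq_int : Integrable q μ) (hq : ∀ z, 0 < q z)
    (hη : Measurable η) (hC : ∀ z, |η z| ≤ C) (ε : ℝ) :
    0 < ∫ z, q z * exp (ε * η z) ∂μ := by
  have hpos : ∀ z, 0 < q z * exp (ε * η z) := fun z => mul_pos (hq z) (exp_pos _)
  rw [integral_pos_iff_support_of_nonneg (fun z => (hpos z).le)
    (integrable_mul_exp hq_int hη hC ε)]
  rw [Function.support_eq_univ fun z => (hpos z).ne']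
  exact NeZero.pos _

lemma abs_tilted_mean_le [NeZero μ] (hq_int : Integrable q μ) (hq : ∀ z, 0 < q z)
    (hη : Measurable η) (hC : ∀ z, |η z| ≤ C) (ε : ℝ) :
    |(∫ z, q z * (exp (ε * η z) * η z) ∂μ) / ∫ z, q z * exp (ε * η z) ∂μ| ≤ C := by
  have hZ := integral_mul_exp_pos hq_int hq hη hC ε
  rw [abs_div, abs_of_pos hZ, div_le_iff₀ hZ, ← integral_const_mul, ← norm_eq_abs]
  refine norm_integral_le_of_norm_le ((integrable_mul_exp hq_int hη hC ε).const_mul C)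
    (.of_forall fun z => ?_)
  rw [← mul_assoc, norm_mul, norm_of_nonneg (mul_pos (hq z) (exp_pos _)).le, mul_comm]
  exact mul_le_mul_of_nonneg_right (hC z) (mul_pos (hq z) (exp_pos _)).le

lemma hasDerivAt_log_integral_mul_exp [NeZero μ] (hq_int : Integrable q μ) (hq : ∀ z, 0 < q z)
    (hη : Measurable η) (hC : ∀ z, |η z| ≤ C) (ε : ℝ) :
    HasDerivAt (fun ε => log (∫ z, q z * exp (ε * η z) ∂μ))
      ((∫ z, q z * (exp (ε * η z) * η z) ∂μ) / ∫ z, q z * exp (ε * η z) ∂μ) ε :=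
  (hasDerivAt_integral_mul_exp hq_int hq hη hC ε).log (integral_mul_exp_pos hq_int hq hη hC ε).ne'

lemma abs_log_integral_mul_exp_sub_le [NeZero μ] (hq_int : Integrable q μ) (hq : ∀ z, 0 < q z)
    (hη : Measurable η) (hC : ∀ z, |η z| ≤ C) (ε : ℝ) :
    |log (∫ z, q z * exp (ε * η z) ∂μ) - log (∫ z, q z ∂μ)| ≤ C * |ε| := by
  have h := Convex.norm_image_sub_le_of_norm_hasDerivWithin_le
    (fun x _ => (hasDerivAt_log_integral_mul_exp hq_int hq hη hC x).hasDerivWithinAt)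
    (fun x _ => abs_tilted_mean_le hq_int hq hη hC x) convex_univ
    (Set.mem_univ 0) (Set.mem_univ ε)
  simpa using h

/-- Differentiation under the integral for `ε ↦ ∫ q e^{εη} f(u e^{L(ε) - εη})`, where
`e^{L(ε) - εη}` stays in a neighbourhood of `1` on which the envelope `B` controls `f` and
`x ↦ x f'(x)`. -/
lemma hasDerivAt_integral_mul_exp_mul_comp {f f' L L' : ℝ → ℝ} {u B : α → ℝ} {c : ℝ}
    (hf' : ∀ x > (0 : ℝ), HasDerivAt f (f' x) x) (hf'_cont : ContinuousOn f' (Set.Ioi 0))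
    (hq_meas : Measurable q) (hq : ∀ z, 0 < q z) (hη : Measurable η) (hC : ∀ z, |η z| ≤ C)
    (hu_meas : Measurable u) (hu : ∀ z, 0 < u z) (hc : 0 < c)
    (hL : ∀ ε, HasDerivAt L (L' ε) ε) (hL' : ∀ ε, |L' ε| ≤ C) (hL_le : ∀ ε, |L ε| ≤ C * |ε|)
    (hB_int : Integrable (fun z => q z * B z) μ)
    (hB : ∀ z, ∀ l ∈ Set.Icc (exp (-c)) (exp c),
      |f (l * u z)| + l * u z * |f' (l * u z)| ≤ B z) :
    HasDerivAt (fun ε => ∫ z, q z * exp (ε * η z) * f (u z * exp (L ε - ε * η z)) ∂μ)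
      (∫ z, q z * (η z * f (u z) + u z * f' (u z) * (L' 0 - η z)) ∂μ) 0 := by
  have hL0 : L 0 = 0 := abs_nonpos_iff.1 (by simpa using hL_le 0)
  have hf_cont : ContinuousOn f (Set.Ioi 0) :=
    fun x hx => (hf' x hx).continuousAt.continuousWithinAt
  have hC0 : 0 ≤ C := (abs_nonneg _).trans (hL' 0)
  have hv_pos : ∀ ε z, 0 < u z * exp (L ε - ε * η z) := fun ε z => mul_pos (hu z) (exp_pos _)
  have hv_meas : ∀ ε, Measurable fun z => u z * exp (L ε - ε * η z) := fun ε => by fun_prop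
  have hF_meas : ∀ ε, Measurable fun z => q z * exp (ε * η z) * f (u z * exp (L ε - ε * η z)) :=
    fun ε => (hq_meas.mul (by fun_prop)).mul
      (hf_cont.measurable_comp_of_mem (hv_meas ε) (hv_pos ε))
  have hB1 : ∀ z, |f (u z)| + u z * |f' (u z)| ≤ B z := fun z => by
    simpa using hB z 1 ⟨exp_le_one_iff.2 (by linarith), one_le_exp hc.le⟩
  have hfu : Measurable fun z => f (u z) := hf_cont.measurable_comp_of_mem hu_meas hu
  have hf'u : Measurable fun z => f' (u z) := hf'_cont.measurable_comp_of_mem hu_meas hu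
  set R := c / (2 * C + 1)
  have hR : 0 < R := by positivity
  have key := (hasDerivAt_integral_of_dominated_loc_of_deriv_le (μ := μ) (x₀ := 0)
    (F := fun ε z => q z * exp (ε * η z) * f (u z * exp (L ε - ε * η z)))
    (F' := fun ε z => q z * (exp (ε * η z) * (η z * f (u z * exp (L ε - ε * η z)) +
      u z * exp (L ε - ε * η z) * f' (u z * exp (L ε - ε * η z)) * (L' ε - η z))))
    (bound := fun z => exp (R * C) * (2 * C) * (q z * B z)) (Metric.ball_mem_nhds 0 hR)
    (.of_forall fun x => (hF_meas x).aestronglyMeasurable) ?_ ?_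
    (.of_forall fun z x hx => ?_) (hB_int.const_mul _) (.of_forall fun z x _ => ?_)).2
  · simpa [hL0] using key
  · refine hB_int.mono' (hF_meas 0).aestronglyMeasurable (.of_forall fun z => ?_)
    simp only [zero_mul, exp_zero, mul_one, hL0, sub_zero, norm_mul, norm_of_nonneg (hq z).le]
    refine mul_le_mul_of_nonneg_left ((le_add_of_nonneg_right ?_).trans (hB1 z)) (hq z).le
    exact mul_nonneg (hu z).le (abs_nonneg _)
  · simp only [zero_mul, exp_zero, mul_one, hL0, sub_zero, one_mul]
    exact (hq_meas.mul ((hη.mul hfu).add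
      ((hu_meas.mul hf'u).mul (measurable_const.sub hη)))).aestronglyMeasurable
  · have hx : |x| ≤ R := by simpa using (Metric.mem_ball.1 hx).le
    have hexp := exp_mul_le_of_abs_le (hC z) hx
    have hxη : |L x - x * η z| ≤ c := by
      have h1 : |x * η z| ≤ R * C := by
        rw [abs_mul]; exact mul_le_mul hx (hC z) (abs_nonneg _) hR.le
      have h2 : C * |x| ≤ C * R := mul_le_mul_of_nonneg_left hx hC0
      have h3 : R * (2 * C + 1) = c := div_mul_cancel₀ _ (by positivity)
      linarith [abs_sub (L x) (x * η z), hL_le x]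
    have hBx := hB z (exp (L x - x * η z)) ⟨exp_le_exp.2 (abs_le.1 hxη).1,
      exp_le_exp.2 (abs_le.1 hxη).2⟩
    rw [mul_comm _ (u z)] at hBx
    set v := u z * exp (L x - x * η z)
    have hv : 0 < v := hv_pos x z
    have hin : |η z * f v + v * f' v * (L' x - η z)| ≤ 2 * C * B z := by
      have hd : |L' x - η z| ≤ 2 * C := by linarith [abs_sub (L' x) (η z), hL' x, hC z]
      calc |η z * f v + v * f' v * (L' x - η z)|
          ≤ |η z| * |f v| + v * |f' v| * |L' x - η z| := by
            refine (abs_add_le _ _).trans_eq ?_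
            rw [abs_mul, abs_mul, abs_mul, abs_of_pos hv]
        _ ≤ 2 * C * |f v| + v * |f' v| * (2 * C) := by
            gcongr
            linarith [hC z]
        _ = 2 * C * (|f v| + v * |f' v|) := by ring
        _ ≤ 2 * C * B z := by gcongr
    rw [norm_mul, norm_mul, norm_of_nonneg (hq z).le, norm_of_nonneg (exp_pos _).le]
    calc q z * (exp (x * η z) * |η z * f v + v * f' v * (L' x - η z)|)
        ≤ q z * (exp (R * C) * (2 * C * B z)) :=
          mul_le_mul_of_nonneg_left (mul_le_mul hexp hin (abs_nonneg _) (exp_pos _).le) (hq z).le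
      _ = exp (R * C) * (2 * C) * (q z * B z) := by ring
  · have he : HasDerivAt (fun x => x * η z) (η z) x := by
      simpa using (hasDerivAt_id x).mul_const (η z)
    have hv : HasDerivAt (fun x => u z * exp (L x - x * η z))
        (u z * (exp (L x - x * η z) * (L' x - η z))) x :=
      (((hL x).sub he).exp).const_mul (u z)
    refine ((he.exp.const_mul (q z)).mul ((hf' _ (hv_pos x z)).comp x hv)).congr_deriv ?_
    simp only [Function.comp_apply]
    ring

end ExponentialTilt

lemma bddAbove_range_envelope {f f' : ℝ → ℝ} (hf : ContinuousOn f (Set.Ioi 0))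
    (hf' : ContinuousOn f' (Set.Ioi 0)) {a : ℝ} (ha : 0 < a) (c : ℝ) :
    BddAbove (Set.range fun l : Set.Icc (exp (-c)) (exp c) =>
      |f ((l : ℝ) * a)| + (l : ℝ) * a * |f' ((l : ℝ) * a)|) := by
  have hmul : Continuous fun l : Set.Icc (exp (-c)) (exp c) => (l : ℝ) * a := by fun_prop
  have hpos : ∀ l : Set.Icc (exp (-c)) (exp c), (l : ℝ) * a ∈ Set.Ioi (0 : ℝ) :=
    fun l => mul_pos ((exp_pos _).trans_le l.2.1) ha
  exact (isCompact_range ((hf.comp_continuous hmul hpos).abs.add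
    (hmul.mul (hf'.comp_continuous hmul hpos).abs))).bddAbove

/-- Lemma 3.3, f-divergence directional derivative.
Let `f : (0,∞) → ℝ` be convex and continuously differentiable (with derivative `f'`),
`q̃, π̃` positive unnormalized densities with finite integrals, `η` bounded measurable.
For `ε` let `q̃_ε = q̃ e^{εη}`, `u_ε(z) = (π̃/q̃_ε)/E_{q_ε}[π̃/q̃_ε]` and
`J_f(ε) = E_{q_ε}[f(u_ε)]`.  With `u = u_0 = (π̃/q̃)·(Z_q/Z_π)`,
`g(u) = u f'(u) - f(u)`, and the stated domination hypothesis, `J_f` is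
differentiable at `0` with `J_f'(0) = Cov_q[η, -g(u)]`. -/
theorem f_divergence_directional_derivative
    (d : ℕ) (f f' : ℝ → ℝ) (qt πt η : (Fin d → ℝ) → ℝ)
    (hf_conv : ConvexOn ℝ (Set.Ioi (0:ℝ)) f)
    (hf' : ∀ x > (0:ℝ), HasDerivAt f (f' x) x)
    (hf'_cont : ContinuousOn f' (Set.Ioi 0))
    (hq_pos : ∀ z, 0 < qt z) (hπ_pos : ∀ z, 0 < πt z)
    (hq_meas : Measurable qt) (hπ_meas : Measurable πt)
    (hq_int : Integrable qt) (hπ_int : Integrable πt)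
    (hη_meas : Measurable η) (hη_bdd : ∃ C : ℝ, ∀ z, |η z| ≤ C)
    (u : (Fin d → ℝ) → ℝ)
    (hu : ∀ z, u z = (πt z / qt z) * ((∫ z', qt z') / (∫ z', πt z')))
    (g : ℝ → ℝ) (hg : ∀ x, g x = x * f' x - f x)
    (hdom : ∃ c > (0:ℝ), Integrable (fun z =>
      qt z * ⨆ l : Set.Icc (Real.exp (-c)) (Real.exp c),
        (|f ((l : ℝ) * u z)| + (l : ℝ) * u z * |f' ((l : ℝ) * u z)|)))
    (J : ℝ → ℝ)
    (hJ : ∀ ε : ℝ, J ε =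
      (∫ z, qt z * Real.exp (ε * η z) *
        f ((πt z / (qt z * Real.exp (ε * η z))) /
          ((∫ z', qt z' * Real.exp (ε * η z') *
              (πt z' / (qt z' * Real.exp (ε * η z')))) /
            (∫ z', qt z' * Real.exp (ε * η z'))))) /
      (∫ z, qt z * Real.exp (ε * η z))) :
    HasDerivAt J
      ((∫ z, qt z * (η z * (-g (u z)))) / (∫ z, qt z)
        - ((∫ z, qt z * η z) / (∫ z, qt z)) *
          ((∫ z, qt z * (-g (u z))) / (∫ z, qt z))) 0 := by
  obtain ⟨C, hC⟩ := hη_bdd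
  obtain ⟨c, hc, hB_int⟩ := hdom
  have hf_cont : ContinuousOn f (Set.Ioi 0) :=
    fun x hx => (hf' x hx).continuousAt.continuousWithinAt
  have hZ := integral_mul_exp_pos hq_int hq_pos hη_meas hC
  have hZq : 0 < ∫ z, qt z := by simpa using hZ 0
  have hZπ : 0 < ∫ z, πt z := by
    simpa using integral_mul_exp_pos hπ_int hπ_pos hη_meas hC 0
  have hu_pos : ∀ z, 0 < u z := fun z => by
    rw [hu]; exact mul_pos (div_pos (hπ_pos z) (hq_pos z)) (div_pos hZq hZπ)
  have hu_meas : Measurable u := by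
    rw [funext hu]; fun_prop
  have hB := fun z => bddAbove_range_envelope hf_cont hf'_cont (hu_pos z) c
  set B : (Fin d → ℝ) → ℝ := fun z => ⨆ l : Set.Icc (exp (-c)) (exp c),
    (|f ((l : ℝ) * u z)| + (l : ℝ) * u z * |f' ((l : ℝ) * u z)|)
  have hB_le : ∀ z, ∀ l ∈ Set.Icc (exp (-c)) (exp c),
      |f (l * u z)| + l * u z * |f' (l * u z)| ≤ B z :=
    fun z l hl => le_ciSup (hB z) ⟨l, hl⟩
  have hB1 : ∀ z, |f (u z)| + u z * |f' (u z)| ≤ B z := fun z => by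
    simpa using hB_le z 1 ⟨exp_le_one_iff.2 (by linarith), one_le_exp hc.le⟩
  set Z : ℝ → ℝ := fun ε => ∫ z, qt z * exp (ε * η z) with hZ_def
  set L : ℝ → ℝ := fun ε => log (Z ε) - log (∫ z, qt z) with hL_def
  have hratio : ∀ ε z, (πt z / (qt z * exp (ε * η z))) /
      ((∫ z', qt z' * exp (ε * η z') * (πt z' / (qt z' * exp (ε * η z')))) /
        (∫ z', qt z' * exp (ε * η z'))) = u z * exp (L ε - ε * η z) := fun ε z => by
    have hcancel : ∀ z', qt z' * exp (ε * η z') * (πt z' / (qt z' * exp (ε * η z'))) = πt z' :=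
      fun z' => mul_div_cancel₀ _ (mul_pos (hq_pos z') (exp_pos _)).ne'
    have hZε : (∫ z', qt z' * exp (ε * η z')) = Z ε := rfl
    have hZ0 : 0 < Z ε := hZ ε
    have hqz := hq_pos z
    simp only [hcancel]
    rw [hZε, hu, exp_sub, exp_sub, exp_log hZ0, exp_log hZq]
    field_simp
  have hJ' : J = fun ε =>
      (∫ z, qt z * exp (ε * η z) * f (u z * exp (L ε - ε * η z))) / Z ε := by
    funext ε
    simp only [hJ, hratio, hZ_def]
  have hnum := hasDerivAt_integral_mul_exp_mul_comp (μ := volume) (L := L) hf' hf'_cont hq_meas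
    hq_pos hη_meas hC hu_meas hu_pos hc
    (fun ε => (hasDerivAt_log_integral_mul_exp hq_int hq_pos hη_meas hC ε).sub_const _)
    (abs_tilted_mean_le hq_int hq_pos hη_meas hC)
    (abs_log_integral_mul_exp_sub_le hq_int hq_pos hη_meas hC) hB_int hB_le
  have hden := hasDerivAt_integral_mul_exp hq_int hq_pos hη_meas hC 0
  have hfu : Measurable fun z => f (u z) := hf_cont.measurable_comp_of_mem hu_meas hu_pos
  have hf'u : Measurable fun z => f' (u z) := hf'_cont.measurable_comp_of_mem hu_meas hu_pos
  have hf_int : Integrable fun z => qt z * f (u z) := by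
    refine hB_int.mono' (hq_meas.mul hfu).aestronglyMeasurable (.of_forall fun z => ?_)
    rw [norm_mul, norm_of_nonneg (hq_pos z).le]
    refine mul_le_mul_of_nonneg_left ((le_add_of_nonneg_right ?_).trans (hB1 z)) (hq_pos z).le
    exact mul_nonneg (hu_pos z).le (abs_nonneg _)
  have hg_int : Integrable fun z => qt z * (-g (u z)) := by
    simp only [hg]
    refine hB_int.mono' (hq_meas.mul ((hu_meas.mul hf'u).sub
      hfu).neg).aestronglyMeasurable (.of_forall fun z => ?_)
    rw [norm_mul, norm_of_nonneg (hq_pos z).le, norm_neg]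
    refine mul_le_mul_of_nonneg_left (le_trans ?_ (hB1 z)) (hq_pos z).le
    refine (abs_sub _ _).trans_eq ?_
    rw [abs_mul, abs_of_pos (hu_pos z), add_comm]
  have hηg_int : Integrable fun z => qt z * (η z * (-g (u z))) := by
    simp only [mul_left_comm (qt _)]
    exact hg_int.bdd_mul hη_meas.aestronglyMeasurable (.of_forall hC)
  rw [hJ']
  refine (hnum.div hden (hZ 0).ne').congr_deriv ?_
  have hL0 : L 0 = 0 := by simp [hL_def, hZ_def]
  simp only [zero_mul, exp_zero, mul_one, one_mul, hL0, sub_zero]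
  set m := (∫ z, qt z * η z) / ∫ z, qt z with hm
  have hsplit : (∫ z, qt z * (η z * f (u z) + u z * f' (u z) * (m - η z))) =
      (∫ z, qt z * (η z * (-g (u z)))) +
        m * ((∫ z, qt z * f (u z)) - ∫ z, qt z * (-g (u z))) := by
    rw [← integral_sub hf_int hg_int, ← integral_const_mul,
      ← integral_add hηg_int (by exact (hf_int.sub hg_int).const_mul m)]
    refine integral_congr_ae (.of_forall fun z => ?_)
    simp only [hg]
    ring
  rw [hsplit, hm]
  field_simp
  ring
end

section
/- Fix α ≠ 0, B > 0 and let π̃: ℝ^d → (0,∞) be measurable with Z_π = ∫ π̃ dz < ∞. Suppose for each t ≥ 0 we are given φ_t: ℝ^d → ℝ, differentiable in t for each fixed z, with q̃_t = e^{φ_t} satisfying Z_{q_t} = ∫ q̃_t dz < ∞, and numbers c_t > 0 and b(t) ∈ ℝ, such that φ_t solves the ODE (d/dt) φ_t(z) = (c_t/(α√B))·( ( (π̃(z)/q̃_t(z))·(Z_{q_t}/Z_π) )^α − 1 ) + b(t) for all z and t. Then the function s̃_t(z) = q̃_t(z)^α = e^{αφ_t(z)} satisfies the linear ODE (d/dt)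 s̃_t(z) + ( c_t/√B − α b(t) )·s̃_t(z) = (c_t/√B)·(Z_{q_t}/Z_π)^α·π̃(z)^α for all z and t. -/
open MeasureTheory Real

/-- change of variables in the proof of Proposition 3.4.
If `φ_t` solves `(d/dt)φ_t(z) = (c_t/(α√B))·(((π̃/q̃_t)·(Z_{q_t}/Z_π))^α - 1) + b(t)`
with `q̃_t = e^{φ_t}`, then `s̃_t = q̃_t^α = e^{αφ_t}` solves the linear ODE
`(d/dt)s̃_t(z) + (c_t/√B - αb(t))·s̃_t(z) = (c_t/√B)·(Z_{q_t}/Z_π)^α·π̃(z)^α`. -/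
theorem alpha_divergence_ODE_change_of_variables
    (d : ℕ) (α B : ℝ) (hα : α ≠ 0) (hB : 0 < B)
    (πt : (Fin d → ℝ) → ℝ)
    (hπ_pos : ∀ z, 0 < πt z) (hπ_meas : Measurable πt)
    (hπ_int : Integrable πt)
    (φ : ℝ → (Fin d → ℝ) → ℝ)
    (qt : ℝ → (Fin d → ℝ) → ℝ)
    (hqt : ∀ t z, qt t z = Real.exp (φ t z))
    (hqt_int : ∀ t ≥ (0:ℝ), Integrable (qt t))
    (c : ℝ → ℝ) (hc_pos : ∀ t ≥ (0:ℝ), 0 < c t) (b : ℝ → ℝ)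
    (hφ' : ∀ t ≥ (0:ℝ), ∀ z,
      HasDerivWithinAt (fun s => φ s z)
        ((c t / (α * Real.sqrt B)) *
            (((πt z / qt t z) * ((∫ z', qt t z') / (∫ z', πt z'))) ^ α - 1)
          + b t)
        (Set.Ici 0) t) :
    ∀ t ≥ (0:ℝ), ∀ z,
      HasDerivWithinAt (fun s => Real.exp (α * φ s z))
        ((c t / Real.sqrt B) * ((∫ z', qt t z') / (∫ z', πt z')) ^ α * πt z ^ α
          - (c t / Real.sqrt B - α * b t) * Real.exp (α * φ t z))
        (Set.Ici 0) t := by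
  intro t ht z
  have hratio : 0 ≤ (∫ z', qt t z') / (∫ z', πt z') :=
    div_nonneg (integral_nonneg fun z' => by simpa [hqt] using (Real.exp_pos (φ t z')).le)
      (integral_nonneg fun z' => (hπ_pos z').le)
  have hq_rpow : qt t z ^ α = Real.exp (α * φ t z) := by
    rw [hqt, ← Real.exp_mul, mul_comm]
  have hq_nonneg : 0 ≤ qt t z := by
    rw [hqt]
    exact (Real.exp_pos _).le
  have hsqrt : Real.sqrt B ≠ 0 := (Real.sqrt_pos.mpr hB).ne'
  convert ((hφ' t ht z).const_mul α).exp using 1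
  rw [Real.mul_rpow (div_nonneg (hπ_pos z).le hq_nonneg) hratio,
    Real.div_rpow (hπ_pos z).le hq_nonneg, hq_rpow]
  have hexp : Real.exp (α * φ t z) ≠ 0 := Real.exp_ne_zero _
  generalize ((∫ z', qt t z') / (∫ z', πt z')) ^ α = R
  field_simp
  ring
end

section
/- Let M ≥ 1 and let q̃_0, q̃_1, …, q̃_M: ℝ^d → (0,∞) be measurable with Z_i = ∫ q̃_i dz < ∞ for each i, with Z_0 = 1 (so q̃_0 is a probability density), and with q̃_M = π̃, so Z_M = Z_π. Write q_i = q̃_i/Z_i and assume q_{i−1}·|log(q̃_i/q̃_{i−1})| is integrable for each i = 1, …, M. Then Σ_{i=1}^{M} D_KL(q_{i−1} || q_i) = log Z_π − Σ_{i=1}^{M} E_{q_{i−1}}[ log( q̃_i(z)/q̃_{i−1}(z) ) ]. (This is the decomposition of the bias of the AIS log-partition-function estimator under perfect transitions: the right-hand side is log Z_π minus the expected log importance weight E[log w], since under perfect transitions E[log w] = Σ_i E_{q_{i−1}}[log(q̃_i/q̃_{i−1})].) -/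
open MeasureTheory Real

theorem integral_pos_of_forall_pos {α : Type*} [MeasurableSpace α] {μ : Measure α} [NeZero μ]
    {f : α → ℝ} (hf : ∀ x, 0 < f x) (hint : Integrable f μ) : 0 < ∫ x, f x ∂μ := by
  rw [integral_pos_iff_support_of_nonneg (fun x => (hf x).le) hint,
    Set.eq_univ_of_forall fun x => Function.mem_support.mpr (hf x).ne']
  exact Measure.measure_univ_pos.mpr (NeZero.ne μ)

theorem integral_div_mul_log_div_eq {α : Type*} [MeasurableSpace α] {μ : Measure α} [NeZero μ]
    {f g : α → ℝ} (hf : ∀ x, 0 < f x) (hg : ∀ x, 0 < g x)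
    (hfi : Integrable f μ) (hgi : Integrable g μ)
    (hlog : Integrable (fun x => f x / (∫ y, f y ∂μ) * |Real.log (g x / f x)|) μ) :
    ∫ x, f x / (∫ y, f y ∂μ) *
        Real.log (f x / (∫ y, f y ∂μ) / (g x / (∫ y, g y ∂μ))) ∂μ
      = Real.log (∫ y, g y ∂μ) - Real.log (∫ y, f y ∂μ)
        - ∫ x, f x / (∫ y, f y ∂μ) * Real.log (g x / f x) ∂μ := by
  have hF := integral_pos_of_forall_pos hf hfi
  have hG := integral_pos_of_forall_pos hg hgi
  set F := ∫ y, f y ∂μ with hF_def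
  set G := ∫ y, g y ∂μ
  have hlog' : Integrable (fun x => f x / F * Real.log (g x / f x)) μ := by
    refine hlog.mono ?_ (Filter.Eventually.of_forall fun x => by simp)
    exact ((hfi.aemeasurable.div_const F).mul
      (hgi.aemeasurable.div hfi.aemeasurable).log).aestronglyMeasurable
  have hpt : ∀ x, f x / F * Real.log (f x / F / (g x / G))
      = f x / F * (Real.log G - Real.log F) - f x / F * Real.log (g x / f x) := by
    intro x
    have h1 := (hf x).ne'
    have h2 := (hg x).ne'
    rw [Real.log_div (div_ne_zero h1 hF.ne') (div_ne_zero h2 hG.ne'), Real.log_div h1 hF.ne',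
      Real.log_div h2 hG.ne', Real.log_div h2 h1]
    ring
  simp_rw [hpt]
  rw [integral_sub ((hfi.div_const F).mul_const _) hlog', integral_mul_const, integral_div,
    ← hF_def, div_self hF.ne', one_mul]

/-- decomposition of the AIS bias under perfect transitions,
Equation (2) of the paper.  For annealing densities `q̃_0, …, q̃_M` with
`Z_0 = ∫ q̃_0 = 1` and `q̃_M = π̃` (so `Z_M = Z_π`), writing `q_i = q̃_i/Z_i`,
`Σ_{i=1}^M D_KL(q_{i-1}‖q_i) = log Z_π - Σ_{i=1}^M E_{q_{i-1}}[log(q̃_i/q̃_{i-1})]`. -/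
theorem AIS_bias_decomposition
    (d M : ℕ) (hM : 1 ≤ M)
    (qt : ℕ → (Fin d → ℝ) → ℝ)
    (hpos : ∀ i ≤ M, ∀ z, 0 < qt i z)
    (hmeas : ∀ i ≤ M, Measurable (qt i))
    (hint : ∀ i ≤ M, Integrable (qt i))
    (hZ0 : (∫ z, qt 0 z) = 1)
    (hlog_int : ∀ i < M,
      Integrable (fun z =>
        (qt i z / (∫ z', qt i z')) * |Real.log (qt (i + 1) z / qt i z)|)) :
    ∑ i ∈ Finset.range M,
      (∫ z, (qt i z / (∫ z', qt i z')) *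
        Real.log ((qt i z / (∫ z', qt i z')) /
          (qt (i + 1) z / (∫ z', qt (i + 1) z'))))
    = Real.log (∫ z, qt M z)
      - ∑ i ∈ Finset.range M,
          (∫ z, (qt i z / (∫ z', qt i z')) *
            Real.log (qt (i + 1) z / qt i z)) := by
  have hstep : ∀ i ∈ Finset.range M, _ := fun i hi =>
    have hi : i < M := Finset.mem_range.mp hi
    integral_div_mul_log_div_eq (hpos i hi.le) (hpos (i + 1) hi) (hint i hi.le)
      (hint (i + 1) hi) (hlog_int i hi)
  rw [Finset.sum_congr rfl hstep, Finset.sum_sub_distrib,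
    Finset.sum_range_sub (fun i => Real.log (∫ z, qt i z)), hZ0, Real.log_one, sub_zero]
end

section
/- Let M ≥ 1, let q_0: ℝ^d → (0,∞) be a probability density, for i = 1, …, M let K_i: ℝ^d × ℝ^d → (0,∞) be measurable with K_i(·|z) positive for all z, let L_i: ℝ^d × ℝ^d → [0,∞) be measurable with ∫ L_i(z | z') dz = 1 for every z' ∈ ℝ^d, and let π̃: ℝ^d → [0,∞) be measurable with Z_π = ∫ π̃(z) dz < ∞. Define the importance weight w(z_{0:M}) = π̃(z_M)·Π_{i=1}^M L_i(z_{i−1}|z_i) / ( q_0(z_0)·Π_{i=1}^M K_i(z_i|z_{i−1}) ). Then the AIS estimator is unbiased: ∫_{(ℝ^d)^{M+1}} q_0(z_0)·Π_{i=1}^M K_i(z_i|z_{i−1}) · w(z_{0:M}) dz_0 ⋯ dz_M = Z_π. -/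
open MeasureTheory Real

/-- Integrating out the states of a backward Markov chain one at a time leaves the integral of the
final weight. -/
theorem lintegral_pi_mul_prod_backward {X : Type*} [MeasurableSpace X] (μ : Measure X)
    [SigmaFinite μ] {f : X → ENNReal} (hf : Measurable f) (M : ℕ)
    (L : Fin M → X → X → ENNReal) (hL : ∀ i, Measurable (Function.uncurry (L i)))
    (hL_prob : ∀ i z', ∫⁻ z, L i z z' ∂μ = 1) :
    ∫⁻ z : Fin (M + 1) → X, f (z (Fin.last M)) * ∏ i : Fin M, L i (z i.castSucc) (z i.succ)
      ∂(Measure.pi fun _ => μ) = ∫⁻ x, f x ∂μ := by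
  induction M with
  | zero =>
    simp only [Finset.univ_eq_empty, Finset.prod_empty, mul_one]
    convert (measurePreserving_funUnique μ (Fin 1)).lintegral_comp hf
    rfl
  | succ M ih =>
    have hmeas : Measurable fun z : Fin (M + 2) → X =>
        f (z (Fin.last (M + 1))) * ∏ i : Fin (M + 1), L i (z i.castSucc) (z i.succ) :=
      (hf.comp (measurable_pi_apply _)).mul <| Finset.measurable_prod _ fun i _ =>
        (hL i).comp
        (f := fun z : Fin (M + 2) → X => (z i.castSucc, z i.succ))
        ((measurable_pi_apply _).prodMk (measurable_pi_apply _))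
    have e := (measurePreserving_piFinSuccAbove (fun _ : Fin (M + 2) => μ) 0).symm
    refine (e.lintegral_comp hmeas).symm.trans <|
      (lintegral_prod_symm _ (hmeas.comp e.measurable).aemeasurable).trans ?_
    rw [← ih (fun i => L i.succ) (fun i => hL i.succ) (fun i => hL_prob i.succ)]
    refine lintegral_congr fun y => ?_
    have hsplit (x : X) : f ((Fin.cons x y : Fin (M + 2) → X) (Fin.last (M + 1))) *
        ∏ i : Fin (M + 1), L i ((Fin.cons x y : Fin (M + 2) → X) i.castSucc)
          ((Fin.cons x y : Fin (M + 2) → X) i.succ) =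
        (f (y (Fin.last M)) * ∏ i : Fin M, L i.succ (y i.castSucc) (y i.succ)) *
          L 0 x (y 0) := by
      rw [Fin.prod_univ_succ, ← Fin.succ_last]
      simp only [Fin.cons_succ, Fin.castSucc_zero, Fin.cons_zero, ← Fin.succ_castSucc]
      ring
    have hL0 : Measurable fun x => L 0 x (y 0) := (hL 0).comp (measurable_id.prodMk measurable_const)
    simp only [Function.comp_apply, MeasurableEquiv.piFinSuccAbove_symm_apply,
      Fin.insertNthEquiv_zero, Fin.consEquiv_apply, hsplit]
    rw [lintegral_const_mul _ hL0, hL_prob, mul_one]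

/-- unbiasedness of the AIS estimator.
With a probability density `q0`, positive measurable forward kernels `K_i`
(`K i z z'` is the density of moving to `z` from `z'`), measurable nonnegative
backward kernels `L_i` which are probability densities in their first argument
(`L i z z'` is `L_i(z | z')`), and a nonnegative measurable target `π̃` with
`Z_π = ∫ π̃ < ∞`, the expectation of the importance weight `w(z_{0:M})` under
the forward Markov process equals `Z_π`. -/
theorem AIS_estimator_unbiased
    (d M : ℕ) (hM : 1 ≤ M)
    (q0 πt : (Fin d → ℝ) → ℝ)
    (K L : Fin M → (Fin d → ℝ) → (Fin d → ℝ) → ℝ)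
    (hq0_meas : Measurable q0) (hq0_pos : ∀ z, 0 < q0 z)
    (hq0_int : Integrable q0) (hq0_prob : (∫ z, q0 z) = 1)
    (hK_meas : ∀ i, Measurable (Function.uncurry (K i)))
    (hK_pos : ∀ i z z', 0 < K i z z')
    (hL_meas : ∀ i, Measurable (Function.uncurry (L i)))
    (hL_nonneg : ∀ i z z', 0 ≤ L i z z')
    (hL_prob : ∀ i z', (∫ z, L i z z') = 1)
    (hπ_meas : Measurable πt) (hπ_nonneg : ∀ z, 0 ≤ πt z)
    (hπ_int : Integrable πt) :
    ∫ z : Fin (M + 1) → (Fin d → ℝ),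
      (q0 (z 0) * ∏ i : Fin M, K i (z i.succ) (z i.castSucc)) *
        (πt (z (Fin.last M)) * (∏ i : Fin M, L i (z i.castSucc) (z i.succ)) /
          (q0 (z 0) * ∏ i : Fin M, K i (z i.succ) (z i.castSucc)))
    = ∫ z', πt z' := by
  have hcancel (z : Fin (M + 1) → Fin d → ℝ) :
      (q0 (z 0) * ∏ i : Fin M, K i (z i.succ) (z i.castSucc)) *
        (πt (z (Fin.last M)) * (∏ i : Fin M, L i (z i.castSucc) (z i.succ)) /
          (q0 (z 0) * ∏ i : Fin M, K i (z i.succ) (z i.castSucc))) =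
      πt (z (Fin.last M)) * ∏ i : Fin M, L i (z i.castSucc) (z i.succ) :=
    mul_div_cancel₀ _
      (mul_pos (hq0_pos _) (Finset.prod_pos fun i _ => hK_pos i _ _)).ne'
  have hmeas : Measurable fun z : Fin (M + 1) → Fin d → ℝ =>
      πt (z (Fin.last M)) * ∏ i : Fin M, L i (z i.castSucc) (z i.succ) :=
    (hπ_meas.comp (measurable_pi_apply _)).mul <| Finset.measurable_prod _ fun i _ =>
      (hL_meas i).comp
        (f := fun z : Fin (M + 1) → Fin d → ℝ => (z i.castSucc, z i.succ))
        ((measurable_pi_apply _).prodMk (measurable_pi_apply _))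
  have hL_lintegral (i : Fin M) (z' : Fin d → ℝ) : ∫⁻ z, ENNReal.ofReal (L i z z') = 1 := by
    have hint : Integrable fun z => L i z z' :=
      Integrable.of_integral_ne_zero (by simp [hL_prob])
    rw [← ofReal_integral_eq_lintegral_ofReal hint (.of_forall fun z => hL_nonneg i z z'),
      hL_prob, ENNReal.ofReal_one]
  simp only [hcancel]
  rw [integral_eq_lintegral_of_nonneg_ae
      (.of_forall fun z => mul_nonneg (hπ_nonneg _) (Finset.prod_nonneg fun i _ => hL_nonneg i _ _))
      hmeas.aestronglyMeasurable,
    integral_eq_lintegral_of_nonneg_ae (.of_forall hπ_nonneg) hπ_meas.aestronglyMeasurable,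
    ← lintegral_pi_mul_prod_backward volume hπ_meas.ennreal_ofReal M
      (fun i z z' => ENNReal.ofReal (L i z z')) (fun i => (hL_meas i).ennreal_ofReal) hL_lintegral]
  simp only [ENNReal.ofReal_mul (hπ_nonneg _),
    ENNReal.ofReal_prod_of_nonneg fun i _ => hL_nonneg i _ _]
  rfl
end
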